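/- Let M be an affine semigroup with atoms m_1, …, m_e and let m ∈ M \ {0}. Then the ω-primality of m satisfies ω(m) = max{ |x| : x ∈ Minimals_≤ Z(m + M) }, where Z(m + M) = ∪_{m' ∈ m + M} Z(m'), Minimals_≤ denotes the set of minimal elements with respect to the componentwise partial order on ℕ^e, and |x| = x_1 + ⋯ + x_e. -/

import Mathlib

/-- The factorization homomorphism `φ : ℕ^e → ℕ^k`, `φ(x) = ∑ xᵢ • mᵢ`. -/
def factorizationHom {k e : ℕ} (m : Fin e → (Fin k → ℕ)) : (Fin e → ℕ) →+ (Fin k → ℕ) where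
  toFun x := ∑ i, x i • m i
  map_zero' := by simp
  map_add' x y := by
    simp [add_smul, Finset.sum_add_distrib]

/-- The length `|x| = x₁ + ⋯ + x_e` of a factorization. -/
def len {e : ℕ} (x : Fin e → ℕ) : ℕ := ∑ i, x i

/-- The set of factorizations `Z(n) = φ⁻¹(n)`. -/
def factsOf {k e : ℕ} (m : Fin e → (Fin k → ℕ)) (n : Fin k → ℕ) : Set (Fin e → ℕ) :=
  {x | factorizationHom m x = n}

/-- `a` is an atom (irreducible element) of `M`. -/
def IsAtomOf {k : ℕ} (M : AddSubmonoid (Fin k → ℕ)) (a : Fin k → ℕ) : Prop :=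
  a ∈ M ∧ a ≠ 0 ∧ ∀ x y, x ∈ M → y ∈ M → a = x + y → x = 0 ∨ y = 0

/-- The divisibility order on `M`: `n ≤_M n'` iff `n' − n ∈ M`. -/
def dvdM {k : ℕ} (M : AddSubmonoid (Fin k → ℕ)) (n n' : Fin k → ℕ) : Prop :=
  ∃ u ∈ M, n' = n + u

/-- The `ω`-primality of `n` in `M`: the least positive integer `N` such that
whenever `n ≤_M a_1 + ⋯ + a_r` with all `a_j ∈ M`, there is a subfamily of at most
`N` of the `a_j` whose sum is still divisible by `n` in `M`. -/
noncomputable def omegaPrimality {k : ℕ} (M : AddSubmonoid (Fin k → ℕ))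
    (n : Fin k → ℕ) : ℕ :=
  sInf {N | 0 < N ∧ ∀ s : Multiset (Fin k → ℕ), (∀ a ∈ s, a ∈ M) →
    dvdM M n s.sum → ∃ t ≤ s, Multiset.card t ≤ N ∧ dvdM M n t.sum}

/-- The set `Z(n + M)` of factorizations of elements of the principal ideal
`n + M`. -/
def factsOfIdeal {k e : ℕ} (m : Fin e → (Fin k → ℕ)) (M : AddSubmonoid (Fin k → ℕ))
    (n : Fin k → ℕ) : Set (Fin e → ℕ) :=
  {x | ∃ n', dvdM M n n' ∧ x ∈ factsOf m n'}

/-- `Minimals_≤ Z(n + M)` with respect to the componentwise order on `ℕ^e`. -/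
def minimalFactsOfIdeal {k e : ℕ} (m : Fin e → (Fin k → ℕ))
    (M : AddSubmonoid (Fin k → ℕ)) (n : Fin k → ℕ) : Set (Fin e → ℕ) :=
  {x | x ∈ factsOfIdeal m M n ∧ ∀ y ∈ factsOfIdeal m M n, y ≤ x → y = x}

theorem mem_factsOfIdeal_iff {k e : ℕ} (m : Fin e → (Fin k → ℕ))
    (M : AddSubmonoid (Fin k → ℕ)) (n : Fin k → ℕ) (x : Fin e → ℕ) :
    x ∈ factsOfIdeal m M n ↔ dvdM M n (factorizationHom m x) := by
  constructor
  · rintro ⟨n', h, rfl⟩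
    exact h
  · intro h
    exact ⟨_, h, rfl⟩

theorem factorizationHom_mem {k e : ℕ} {m : Fin e → (Fin k → ℕ)}
    {M : AddSubmonoid (Fin k → ℕ)} (hm : ∀ i, m i ∈ M) (x : Fin e → ℕ) :
    factorizationHom m x ∈ M :=
  show ∑ i, x i • m i ∈ M from sum_mem fun i _ => nsmul_mem (hm i) _

theorem exists_factorization_of_mem_closure {k e : ℕ} (m : Fin e → (Fin k → ℕ))
    {a : Fin k → ℕ} (ha : a ∈ AddSubmonoid.closure (Set.range m)) :
    ∃ x, factorizationHom m x = a := by
  have h : AddSubmonoid.closure (Set.range m) ≤ AddMonoidHom.mrange (factorizationHom m) := by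
    rw [AddSubmonoid.closure_le]
    rintro _ ⟨i, rfl⟩
    refine ⟨Pi.single i 1, ?_⟩
    simp [factorizationHom, Pi.single_apply]
  exact h ha

theorem factorizationHom_count {k e : ℕ} (m : Fin e → (Fin k → ℕ)) (t : Multiset (Fin e)) :
    factorizationHom m (fun i => t.count i) = (t.map m).sum := by
  rw [Finset.sum_multiset_map_count]
  change ∑ i, t.count i • m i = _
  refine (Finset.sum_subset (Finset.subset_univ _) fun i _ hi => ?_).symm
  rw [Multiset.mem_toFinset] at hi
  simp [Multiset.count_eq_zero_of_notMem hi]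

theorem len_count {e : ℕ} (t : Multiset (Fin e)) :
    len (fun i => t.count i) = t.card :=
  Multiset.sum_count_eq_card fun _ _ => Finset.mem_univ _

theorem len_lt_len {e : ℕ} {x y : Fin e → ℕ} (h : x < y) : len x < len y :=
  Fintype.sum_strictMono h

/-- Every multiplicity vector is realised by a multiset. -/
theorem exists_multiset_count_eq {e : ℕ} (x : Fin e → ℕ) :
    ∃ s : Multiset (Fin e), ∀ i, s.count i = x i :=
  ⟨Finsupp.toMultiset (Finsupp.equivFunOnFinite.symm x), fun i => by
    simp [Finsupp.count_toMultiset]⟩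

theorem Multiset.exists_le_of_le_map {α β : Type*} {f : α → β} {s : Multiset α}
    {t : Multiset β} (h : t ≤ s.map f) : ∃ u ≤ s, t = u.map f := by
  induction s using Quotient.inductionOn with | _ s
  induction t using Quotient.inductionOn with | _ t
  obtain ⟨l, hl, hs⟩ : t.Subperm (s.map f) := h
  obtain ⟨l', hl', rfl⟩ := List.sublist_map_iff.1 hs
  exact ⟨l', hl'.subperm, (Multiset.coe_eq_coe.2 hl).symm⟩

/-- A vector below the sum of a family is already below the sum of a subfamily of at most
`len x` members. -/
theorem exists_le_card_le_len {α : Type*} {e : ℕ} (f : α → (Fin e → ℕ)) (s : Multiset α)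
    (x : Fin e → ℕ) (hx : x ≤ (s.map f).sum) :
    ∃ t ≤ s, t.card ≤ len x ∧ x ≤ (t.map f).sum := by
  induction s using Multiset.induction generalizing x with
  | empty => exact ⟨0, le_rfl, by simp, hx⟩
  | cons a s ih =>
    rw [Multiset.map_cons, Multiset.sum_cons] at hx
    obtain ⟨t, hts, hcard, hle⟩ := ih (x - f a) (tsub_le_iff_left.2 hx)
    rcases (tsub_le_self : x - f a ≤ x).eq_or_lt with h | h
    · rw [h] at hcard hle
      exact ⟨t, hts.trans (Multiset.le_cons_self s a), hcard, hle⟩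
    · refine ⟨a ::ₘ t, Multiset.cons_le_cons a hts, ?_, ?_⟩
      · rw [Multiset.card_cons]
        exact Nat.succ_le_of_lt (hcard.trans_lt (len_lt_len h))
      · rw [Multiset.map_cons, Multiset.sum_cons]
        exact tsub_le_iff_left.1 hle

theorem exists_minimalFactsOfIdeal_le {k e : ℕ} {m : Fin e → (Fin k → ℕ)}
    {M : AddSubmonoid (Fin k → ℕ)} {n : Fin k → ℕ} {z : Fin e → ℕ}
    (hz : z ∈ factsOfIdeal m M n) : ∃ x ∈ minimalFactsOfIdeal m M n, x ≤ z := by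
  obtain ⟨x, hxz, hx⟩ := exists_minimal_le_of_wellFoundedLT (· ∈ factsOfIdeal m M n) z hz
  exact ⟨x, ⟨hx.prop, fun y hy hyx => hx.eq_of_le hy hyx⟩, hxz⟩

theorem finite_minimalFactsOfIdeal {k e : ℕ} (m : Fin e → (Fin k → ℕ))
    (M : AddSubmonoid (Fin k → ℕ)) (n : Fin k → ℕ) :
    (minimalFactsOfIdeal m M n).Finite :=
  WellQuasiOrderedLE.finite_of_isAntichain fun _ hx _ hy hne hle =>
    hne (hy.2 _ hx.1 hle)

/-- Bounds on the lengths of the minimal factorizations of `n + M` have the subfamily property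
defining the `ω`-primality. -/
theorem exists_subfamily_of_len_le {k e : ℕ} {m : Fin e → (Fin k → ℕ)}
    {M : AddSubmonoid (Fin k → ℕ)} (hgen : AddSubmonoid.closure (Set.range m) = M)
    {n : Fin k → ℕ} {N : ℕ} (hN : ∀ x ∈ minimalFactsOfIdeal m M n, len x ≤ N)
    (s : Multiset (Fin k → ℕ)) (hs : ∀ a ∈ s, a ∈ M) (hdvd : dvdM M n s.sum) :
    ∃ t ≤ s, t.card ≤ N ∧ dvdM M n t.sum := by
  have hm : ∀ i, m i ∈ M := fun i => hgen ▸ AddSubmonoid.subset_closure ⟨i, rfl⟩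
  have hex : ∀ a, ∃ x, a ∈ M → factorizationHom m x = a := fun a => by
    by_cases ha : a ∈ M
    · obtain ⟨x, hx⟩ := exists_factorization_of_mem_closure m (hgen ▸ ha)
      exact ⟨x, fun _ => hx⟩
    · exact ⟨0, fun h => absurd h ha⟩
  choose f hf using hex
  have hsum : ∀ t ≤ s, factorizationHom m (t.map f).sum = t.sum := fun t ht => by
    rw [map_multiset_sum, Multiset.map_map,
      Multiset.map_congr rfl (f := factorizationHom m ∘ f) (g := id) fun a ha => hf a (hs a (Multiset.mem_of_le ht ha)),
      Multiset.map_id]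
  obtain ⟨x, hx, hxle⟩ := exists_minimalFactsOfIdeal_le
    ((mem_factsOfIdeal_iff m M n (s.map f).sum).2 (by rwa [hsum s le_rfl]))
  obtain ⟨t, hts, hcard, hle⟩ := exists_le_card_le_len f s x hxle
  refine ⟨t, hts, hcard.trans (hN x hx), ?_⟩
  obtain ⟨u, hu, hxu⟩ := (mem_factsOfIdeal_iff m M n x).1 hx.1
  obtain ⟨w, hw⟩ := exists_add_of_le hle
  refine ⟨u + factorizationHom m w, add_mem hu (factorizationHom_mem hm w), ?_⟩
  rw [← hsum t hts, hw, map_add, hxu, add_assoc]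

/-- The subfamily property defining the `ω`-primality bounds the lengths of the minimal
factorizations of `n + M`. -/
theorem len_le_of_exists_subfamily {k e : ℕ} {m : Fin e → (Fin k → ℕ)}
    {M : AddSubmonoid (Fin k → ℕ)} (hm : ∀ i, m i ∈ M) {n : Fin k → ℕ} {N : ℕ}
    (hN : ∀ s : Multiset (Fin k → ℕ), (∀ a ∈ s, a ∈ M) → dvdM M n s.sum →
      ∃ t ≤ s, t.card ≤ N ∧ dvdM M n t.sum)
    {x : Fin e → ℕ} (hx : x ∈ minimalFactsOfIdeal m M n) : len x ≤ N := by
  obtain ⟨s, hs⟩ := exists_multiset_count_eq x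
  obtain rfl : (fun i => s.count i) = x := funext hs
  obtain ⟨t, hts, hcard, hdvd⟩ := hN (s.map m)
    (fun a ha => by
      obtain ⟨i, -, rfl⟩ := Multiset.mem_map.1 ha
      exact hm i)
    (by rw [← factorizationHom_count, ← mem_factsOfIdeal_iff]; exact hx.1)
  obtain ⟨u, hus, rfl⟩ := Multiset.exists_le_of_le_map hts
  rw [← factorizationHom_count, ← mem_factsOfIdeal_iff] at hdvd
  rw [← hx.2 _ hdvd fun i => Multiset.count_le_of_le i hus, len_count]
  rwa [Multiset.card_map] at hcard

/-- Let `M` be an affine semigroup with atoms `m_1, …, m_e` and `0 ≠ n ∈ M`.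
Then `ω(n) = max{|x| : x ∈ Minimals_≤ Z(n + M)}`. -/
theorem omega_primality_eq_max_len_minimal_facts (k e : ℕ) (m : Fin e → (Fin k → ℕ))
    (M : AddSubmonoid (Fin k → ℕ))
    (hgen : AddSubmonoid.closure (Set.range m) = M)
    (hinj : Function.Injective m)
    (hatoms : ∀ i, IsAtomOf M (m i))
    (n : Fin k → ℕ) (hn : n ∈ M) (hn0 : n ≠ 0) :
    IsGreatest {c : ℕ | ∃ x ∈ minimalFactsOfIdeal m M n, c = len x}
      (omegaPrimality M n) := by
  have hm : ∀ i, m i ∈ M := fun i => (hatoms i).1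
  obtain ⟨z, hz⟩ := exists_factorization_of_mem_closure m (hgen ▸ hn)
  obtain ⟨x₀, hx₀, -⟩ := exists_minimalFactsOfIdeal_le
    ((mem_factsOfIdeal_iff m M n z).2 ⟨0, zero_mem M, by rw [hz, add_zero]⟩)
  obtain ⟨x, hx, hmax⟩ := Set.exists_max_image _ len (finite_minimalFactsOfIdeal m M n) ⟨x₀, hx₀⟩
  have hpos : 0 < len x := by
    have hne : x ≠ 0 := by
      rintro rfl
      obtain ⟨u, -, hu⟩ := (mem_factsOfIdeal_iff m M n 0).1 hx.1
      rw [map_zero] at hu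
      exact hn0 (add_eq_zero.1 hu.symm).1
    simpa [len] using len_lt_len (pos_iff_ne_zero.2 hne)
  have homega : IsLeast {N | 0 < N ∧ ∀ s : Multiset (Fin k → ℕ), (∀ a ∈ s, a ∈ M) →
      dvdM M n s.sum → ∃ t ≤ s, Multiset.card t ≤ N ∧ dvdM M n t.sum} (len x) :=
    ⟨⟨hpos, exists_subfamily_of_len_le hgen hmax⟩,
      fun N hN => len_le_of_exists_subfamily hm hN.2 hx⟩
  rw [omegaPrimality, homega.csInf_eq]
  refine ⟨⟨x, hx, rfl⟩, ?_⟩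
  rintro _ ⟨y, hy, rfl⟩
  exact hmax y hy
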